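/- Let B denote the space of bounded measurable real functions on [0,1], let A : B → B be linear with a measurable ω : [0,1]² → [0,∞) satisfying ∫₀¹ ω(u,s) du ≤ 1 for every s and |(Ah)(s)| ≤ ∫₀¹ |h(u)| ω(u,s) du for all h ∈ B and s ∈ [0,1]. Let α, α̂, β, β̂ ∈ B with sup_s |α(s)| ≤ ᾱ, sup_s |β(s)| ≤ β̄, sup_s |α̂(s) − α(s)| ≤ c, and sup_s |β̂(s) − β(s)| ≤ c, where ᾱ, β̄ ≥ 0 and c ≥ 0 satisfy ᾱ + c < 1. Define γ(h,s) := α(s)·(Ah)(s) and γ̂(h,s) := α̂(s)·(Ah)(s), with iterates γ⁰(h,s) := h(s), γ^ℓ(h,s) := γ(γ^{ℓ−1}(h,·), s), and similarly for γ̂. Let W be an n×n real matrix with ‖W‖_∞ ≤ 1, e_i ∈ ℝⁿ the i-th standard basis vector, M(s) := Σ_{ℓ=0}^∞ W^ℓ e_i γ^ℓ(β,s) and, for an integer S ≥ 0, M̂^S(s) := Σ_{ℓ=0}^S W^ℓ e_i γ̂^ℓ(β̂,s). Then for every i, every s ∈ [0,1], and every S ≥ 0, max_{1≤k≤n} |M̂^S(s)_k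 − M(s)_k| ≤ c/(1 − ᾱ − c) + c β̄/(1 − ᾱ − c)² + β̄ ᾱ^{S+1}/(1 − ᾱ). -/

import Mathlib

open MeasureTheory Matrix

/-- Membership in `B`, the space of bounded measurable real functions on `[0,1]`
(modelled as measurable functions `ℝ → ℝ` that are bounded on `[0,1]`). -/
def IsBddMeas (h : ℝ → ℝ) : Prop :=
  Measurable h ∧ ∃ M : ℝ, ∀ s ∈ Set.Icc (0 : ℝ) 1, |h s| ≤ M

/-- The iterates `γ⁰(h,s) = h(s)`, `γ^ℓ(h,s) = α(s) · (A γ^{ℓ−1}(h,·))(s)`. -/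
noncomputable def gammaIter (α : ℝ → ℝ) (A : (ℝ → ℝ) → ℝ → ℝ) : ℕ → (ℝ → ℝ) → ℝ → ℝ
  | 0, h => h
  | ℓ + 1, h => fun s => α s * A (gammaIter α A ℓ h) s

lemma IsBddMeas.mul {f g : ℝ → ℝ} (hf : IsBddMeas f) (hg : IsBddMeas g) :
    IsBddMeas (fun s => f s * g s) := by
  obtain ⟨hfm, M, hM⟩ := hf
  obtain ⟨hgm, N, hN⟩ := hg
  refine ⟨hfm.mul hgm, M * N, fun s hs => ?_⟩
  rw [abs_mul]
  exact mul_le_mul (hM s hs) (hN s hs) (abs_nonneg _) ((abs_nonneg _).trans (hM s hs))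

lemma IsBddMeas.add {f g : ℝ → ℝ} (hf : IsBddMeas f) (hg : IsBddMeas g) :
    IsBddMeas (f + g) := by
  obtain ⟨hfm, M, hM⟩ := hf
  obtain ⟨hgm, N, hN⟩ := hg
  exact ⟨hfm.add hgm, M + N, fun s hs =>
    (abs_add_le _ _).trans (add_le_add (hM s hs) (hN s hs))⟩

lemma IsBddMeas.const_smul {f : ℝ → ℝ} (hf : IsBddMeas f) (a : ℝ) : IsBddMeas (a • f) := by
  obtain ⟨hfm, M, hM⟩ := hf
  refine ⟨hfm.const_smul a, |a| * M, fun s hs => ?_⟩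
  rw [Pi.smul_apply, smul_eq_mul, abs_mul]
  exact mul_le_mul_of_nonneg_left (hM s hs) (abs_nonneg a)

lemma IsBddMeas.gammaIter {A : (ℝ → ℝ) → ℝ → ℝ} (hAB : ∀ h, IsBddMeas h → IsBddMeas (A h))
    {α h : ℝ → ℝ} (hα : IsBddMeas α) (hh : IsBddMeas h) (ℓ : ℕ) :
    IsBddMeas (gammaIter α A ℓ h) := by
  induction ℓ with
  | zero => exact hh
  | succ ℓ ih => exact hα.mul (hAB _ ih)

/-- A subprobability density averages a function bounded by `K` to at most `K`. -/
lemma integral_abs_mul_le_of_lintegral_le_one {h w : ℝ → ℝ} (hw : Measurable w)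
    (hw0 : ∀ u, 0 ≤ w u) (hw1 : ∫⁻ u in Set.Icc (0 : ℝ) 1, ENNReal.ofReal (w u) ≤ 1)
    {K : ℝ} (hK : 0 ≤ K) (hh : ∀ u ∈ Set.Icc (0 : ℝ) 1, |h u| ≤ K) :
    ∫ u in Set.Icc (0 : ℝ) 1, |h u| * w u ≤ K := by
  have hint : Integrable w (volume.restrict (Set.Icc (0 : ℝ) 1)) := by
    refine ⟨hw.aestronglyMeasurable, ?_⟩
    rw [hasFiniteIntegral_iff_ofReal (ae_of_all _ hw0)]
    exact hw1.trans_lt ENNReal.one_lt_top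
  have hle : ∫ u in Set.Icc (0 : ℝ) 1, w u ≤ 1 := by
    rw [integral_eq_lintegral_of_nonneg_ae (ae_of_all _ hw0) hw.aestronglyMeasurable]
    exact ENNReal.toReal_mono ENNReal.one_ne_top hw1
  calc ∫ u in Set.Icc (0 : ℝ) 1, |h u| * w u
      ≤ ∫ u in Set.Icc (0 : ℝ) 1, K * w u := by
        refine integral_mono_of_nonneg
          (ae_of_all _ fun u => mul_nonneg (abs_nonneg _) (hw0 u)) (hint.const_mul K) ?_
        filter_upwards [ae_restrict_mem measurableSet_Icc] with u hu
        exact mul_le_mul_of_nonneg_right (hh u hu) (hw0 u)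
    _ = K * ∫ u in Set.Icc (0 : ℝ) 1, w u := integral_const_mul _ _
    _ ≤ K := mul_le_of_le_one_right hK hle

lemma abs_gammaIter_le {A : (ℝ → ℝ) → ℝ → ℝ} (hAB : ∀ h, IsBddMeas h → IsBddMeas (A h))
    (hA : ∀ h, IsBddMeas h → ∀ K : ℝ, 0 ≤ K → (∀ u ∈ Set.Icc (0 : ℝ) 1, |h u| ≤ K) →
      ∀ s ∈ Set.Icc (0 : ℝ) 1, |A h s| ≤ K)
    {α h : ℝ → ℝ} (hα : IsBddMeas α) (hh : IsBddMeas h) {a b : ℝ} (ha : 0 ≤ a) (hb : 0 ≤ b)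
    (hαa : ∀ s ∈ Set.Icc (0 : ℝ) 1, |α s| ≤ a) (hhb : ∀ s ∈ Set.Icc (0 : ℝ) 1, |h s| ≤ b)
    (ℓ : ℕ) : ∀ s ∈ Set.Icc (0 : ℝ) 1, |gammaIter α A ℓ h s| ≤ b * a ^ ℓ := by
  induction ℓ with
  | zero => simpa [gammaIter] using hhb
  | succ ℓ ih =>
    intro s hs
    have hAs := hA _ (hα.gammaIter hAB hh ℓ) _ (by positivity) ih s hs
    calc |α s * A (gammaIter α A ℓ h) s| = |α s| * |A (gammaIter α A ℓ h) s| := abs_mul _ _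
      _ ≤ a * (b * a ^ ℓ) := mul_le_mul (hαa s hs) hAs (abs_nonneg _) ha
      _ = b * a ^ (ℓ + 1) := by ring

lemma abs_gammaIter_sub_le {A : (ℝ → ℝ) → ℝ → ℝ}
    (hAB : ∀ h, IsBddMeas h → IsBddMeas (A h))
    (hadd : ∀ f g, IsBddMeas f → IsBddMeas g → A (f + g) = A f + A g)
    (hsmul : ∀ (c : ℝ) (f : ℝ → ℝ), IsBddMeas f → A (c • f) = c • A f)
    (hA : ∀ h, IsBddMeas h → ∀ K : ℝ, 0 ≤ K → (∀ u ∈ Set.Icc (0 : ℝ) 1, |h u| ≤ K) →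
      ∀ s ∈ Set.Icc (0 : ℝ) 1, |A h s| ≤ K)
    {α α' h h' : ℝ → ℝ} (hα : IsBddMeas α) (hα' : IsBddMeas α')
    (hh : IsBddMeas h) (hh' : IsBddMeas h') {a b c : ℝ}
    (ha : 0 ≤ a) (hb : 0 ≤ b) (hc : 0 ≤ c)
    (hαa : ∀ s ∈ Set.Icc (0 : ℝ) 1, |α s| ≤ a) (hhb : ∀ s ∈ Set.Icc (0 : ℝ) 1, |h s| ≤ b)
    (hαd : ∀ s ∈ Set.Icc (0 : ℝ) 1, |α' s - α s| ≤ c)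
    (hhd : ∀ s ∈ Set.Icc (0 : ℝ) 1, |h' s - h s| ≤ c) (ℓ : ℕ) :
    ∀ s ∈ Set.Icc (0 : ℝ) 1, |gammaIter α' A ℓ h' s - gammaIter α A ℓ h s| ≤
      c * (a + c) ^ ℓ + c * b * (ℓ * (a + c) ^ (ℓ - 1)) := by
  induction ℓ with
  | zero => simpa [gammaIter] using hhd
  | succ ℓ ih =>
    intro s hs
    set g := gammaIter α A ℓ h
    set g' := gammaIter α' A ℓ h'
    have hgB : IsBddMeas g := hα.gammaIter hAB hh ℓ
    have hgB' : IsBddMeas g' := hα'.gammaIter hAB hh' ℓ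
    have hAg : |A g s| ≤ b * a ^ ℓ := hA g hgB _ (by positivity)
      (abs_gammaIter_le hAB hA hα hh ha hb hαa hhb ℓ) s hs
    have hAd : |A g' s - A g s| ≤ c * (a + c) ^ ℓ + c * b * (ℓ * (a + c) ^ (ℓ - 1)) := by
      have hgd := hA (g' + (-1 : ℝ) • g) (hgB'.add (hgB.const_smul _))
        (c * (a + c) ^ ℓ + c * b * (ℓ * (a + c) ^ (ℓ - 1))) (by positivity)
        (fun u hu => by simpa [sub_eq_add_neg] using ih u hu) s hs
      rw [hadd _ _ hgB' (hgB.const_smul _), hsmul _ _ hgB] at hgd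
      simpa [sub_eq_add_neg] using hgd
    have hα's : |α' s| ≤ a + c := by
      have := abs_add_le (α s) (α' s - α s)
      rw [add_sub_cancel] at this
      linarith [hαa s hs, hαd s hs]
    have hpow : a ^ ℓ ≤ (a + c) ^ ℓ := pow_le_pow_left₀ ha (by linarith) ℓ
    have hder : (a + c) * ((ℓ : ℝ) * (a + c) ^ (ℓ - 1)) = ℓ * (a + c) ^ ℓ := by
      cases ℓ with
      | zero => simp
      | succ m => rw [Nat.add_sub_cancel]; ring
    calc |α' s * A g' s - α s * A g s|
        = |α' s * (A g' s - A g s) + (α' s - α s) * A g s| := by congr 1; ring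
      _ ≤ |α' s| * |A g' s - A g s| + |α' s - α s| * |A g s| := by
        simpa only [abs_mul] using abs_add_le (α' s * (A g' s - A g s)) ((α' s - α s) * A g s)
      _ ≤ (a + c) * (c * (a + c) ^ ℓ + c * b * (ℓ * (a + c) ^ (ℓ - 1))) +
          c * (b * (a + c) ^ ℓ) := by
        refine add_le_add (mul_le_mul hα's hAd (abs_nonneg _) (by positivity))
          (mul_le_mul (hαd s hs) (hAg.trans ?_) (abs_nonneg _) hc)
        exact mul_le_mul_of_nonneg_left hpow hb
      _ = c * (a + c) ^ (ℓ + 1) + c * b * ((ℓ + 1 : ℕ) * (a + c) ^ (ℓ + 1 - 1)) := by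
        rw [Nat.add_sub_cancel]
        push_cast
        linear_combination c * b * hder

lemma sum_range_mul_pow_pred_le {r : ℝ} (hr : 0 ≤ r) (hr1 : r < 1) (N : ℕ) :
    ∑ ℓ ∈ Finset.range (N + 1), (ℓ * r ^ (ℓ - 1) : ℝ) ≤ 1 / (1 - r) ^ 2 := by
  have hs := hasSum_choose_mul_geometric_of_norm_lt_one 1
    (by rwa [Real.norm_of_nonneg hr] : ‖r‖ < 1)
  rw [Finset.sum_range_succ']
  simpa using sum_le_hasSum (Finset.range N) (fun ℓ _ => by positivity) hs

lemma abs_pow_mulVec_le_one {ι : Type*} [Fintype ι] [DecidableEq ι] {W : Matrix ι ι ℝ}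
    (hW : ∀ k, ∑ j, |W k j| ≤ 1) {v : ι → ℝ} (hv : ∀ k, |v k| ≤ 1) (ℓ : ℕ) :
    ∀ k, |((W ^ ℓ) *ᵥ v) k| ≤ 1 := by
  induction ℓ with
  | zero => simpa using hv
  | succ ℓ ih =>
    intro k
    rw [pow_succ', ← mulVec_mulVec]
    calc |∑ j, W k j * ((W ^ ℓ) *ᵥ v) j| ≤ ∑ j, |W k j * ((W ^ ℓ) *ᵥ v) j| :=
          Finset.abs_sum_le_sum_abs _ _
      _ ≤ ∑ j, |W k j| := Finset.sum_le_sum fun j _ => by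
          rw [abs_mul]
          exact mul_le_of_le_one_right (abs_nonneg _) (ih j)
      _ ≤ 1 := hW k

/-- estimation error of the truncated Neumann-type series.  With
`M(s) = Σ_{ℓ=0}^∞ W^ℓ e_i γ^ℓ(β,s)` and `M̂^S(s) = Σ_{ℓ=0}^S W^ℓ e_i γ̂^ℓ(β̂,s)`, if
`sup |α| ≤ ᾱ`, `sup |β| ≤ β̄`, `sup |α̂ − α| ≤ c`, `sup |β̂ − β| ≤ c` with `ᾱ + c < 1`,
and `‖W‖_∞ ≤ 1`, then every component satisfies
`|M̂^S(s)_k − M(s)_k| ≤ c/(1−ᾱ−c) + c β̄/(1−ᾱ−c)² + β̄ ᾱ^{S+1}/(1−ᾱ)`. -/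
theorem stmt18 (A : (ℝ → ℝ) → ℝ → ℝ)
    (hadd : ∀ f g, IsBddMeas f → IsBddMeas g → A (f + g) = A f + A g)
    (hsmul : ∀ (c : ℝ) (f : ℝ → ℝ), IsBddMeas f → A (c • f) = c • A f)
    (hAB : ∀ h, IsBddMeas h → IsBddMeas (A h))
    (ω : ℝ → ℝ → ℝ)
    (hωmeas : Measurable (Function.uncurry ω))
    (hωpos : ∀ u s, 0 ≤ ω u s)
    (hωint : ∀ s ∈ Set.Icc (0 : ℝ) 1,
      ∫⁻ u in Set.Icc (0 : ℝ) 1, ENNReal.ofReal (ω u s) ≤ 1)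
    (hdom : ∀ h, IsBddMeas h → ∀ s ∈ Set.Icc (0 : ℝ) 1,
      |A h s| ≤ ∫ u in Set.Icc (0 : ℝ) 1, |h u| * ω u s)
    (α αhat β βhat : ℝ → ℝ)
    (hα : IsBddMeas α) (hαhat : IsBddMeas αhat)
    (hβ : IsBddMeas β) (hβhat : IsBddMeas βhat)
    (abar bbar c : ℝ) (habar : 0 ≤ abar) (hbbar : 0 ≤ bbar) (hc : 0 ≤ c)
    (hsum1 : abar + c < 1)
    (hαb : ∀ s ∈ Set.Icc (0 : ℝ) 1, |α s| ≤ abar)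
    (hβb : ∀ s ∈ Set.Icc (0 : ℝ) 1, |β s| ≤ bbar)
    (hαd : ∀ s ∈ Set.Icc (0 : ℝ) 1, |αhat s - α s| ≤ c)
    (hβd : ∀ s ∈ Set.Icc (0 : ℝ) 1, |βhat s - β s| ≤ c)
    {n : ℕ} (W : Matrix (Fin n) (Fin n) ℝ) (hW : ∀ k, ∑ j, |W k j| ≤ 1)
    (i : Fin n) (s : ℝ) (hs : s ∈ Set.Icc (0 : ℝ) 1) (S : ℕ) :
    ∀ k : Fin n,
      |(∑ ℓ ∈ Finset.range (S + 1),
          ((W ^ ℓ) *ᵥ Pi.single i 1) k * gammaIter αhat A ℓ βhat s) -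
        (∑' ℓ : ℕ, ((W ^ ℓ) *ᵥ Pi.single i 1) k * gammaIter α A ℓ β s)| ≤
      c / (1 - abar - c) + c * bbar / (1 - abar - c) ^ 2 +
        bbar * abar ^ (S + 1) / (1 - abar) := by
  intro k
  have hA : ∀ h, IsBddMeas h → ∀ K : ℝ, 0 ≤ K → (∀ u ∈ Set.Icc (0 : ℝ) 1, |h u| ≤ K) →
      ∀ s ∈ Set.Icc (0 : ℝ) 1, |A h s| ≤ K := fun h hh K hK hhK s hs =>
    (hdom h hh s hs).trans (integral_abs_mul_le_of_lintegral_le_one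
      (hωmeas.comp (measurable_id.prodMk measurable_const)) (fun u => hωpos u s)
      (hωint s hs) hK hhK)
  have hγ := fun ℓ => abs_gammaIter_le hAB hA hα hβ habar hbbar hαb hβb ℓ s hs
  have hd := fun ℓ => abs_gammaIter_sub_le hAB hadd hsmul hA hα hαhat hβ hβhat habar hbbar hc
    hαb hβb hαd hβd ℓ s hs
  have hv : ∀ j, |(Pi.single i 1 : Fin n → ℝ) j| ≤ 1 := fun j => by
    by_cases hj : j = i
    · subst hj; simp
    · simp [hj]
  have hw := fun ℓ => abs_pow_mulVec_le_one hW hv ℓ k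
  set w : ℕ → ℝ := fun ℓ => ((W ^ ℓ) *ᵥ Pi.single i 1) k
  set g : ℕ → ℝ := fun ℓ => gammaIter α A ℓ β s
  set g' : ℕ → ℝ := fun ℓ => gammaIter αhat A ℓ βhat s
  change |∑ ℓ ∈ Finset.range (S + 1), w ℓ * g' ℓ - ∑' ℓ, w ℓ * g ℓ| ≤ _
  have hterm : ∀ ℓ, ‖w ℓ * g ℓ‖ ≤ bbar * abar ^ ℓ := fun ℓ => by
    rw [Real.norm_eq_abs, abs_mul]
    exact (mul_le_of_le_one_left (abs_nonneg _) (hw ℓ)).trans (hγ ℓ)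
  have hgeom : HasSum (fun ℓ => bbar * abar ^ ℓ) (bbar * (1 - abar)⁻¹) :=
    (hasSum_geometric_of_lt_one habar (by linarith)).mul_left bbar
  have hsum : Summable fun ℓ => w ℓ * g ℓ := .of_norm_bounded hgeom.summable hterm
  have htail : |∑' ℓ, w (ℓ + (S + 1)) * g (ℓ + (S + 1))| ≤
      bbar * abar ^ (S + 1) / (1 - abar) := by
    refine tsum_of_norm_bounded (f := fun ℓ => w (ℓ + (S + 1)) * g (ℓ + (S + 1)))
      (g := fun ℓ => abar ^ (S + 1) * (bbar * abar ^ ℓ)) ?_ fun ℓ => ?_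
    · rw [div_eq_mul_inv, mul_comm bbar, mul_assoc]
      exact hgeom.mul_left (abar ^ (S + 1))
    · refine (hterm _).trans_eq ?_
      ring
  have hhead : |∑ ℓ ∈ Finset.range (S + 1), w ℓ * (g' ℓ - g ℓ)| ≤
      c / (1 - abar - c) + c * bbar / (1 - abar - c) ^ 2 := by
    have hr : 0 ≤ abar + c := by positivity
    calc |∑ ℓ ∈ Finset.range (S + 1), w ℓ * (g' ℓ - g ℓ)|
        ≤ ∑ ℓ ∈ Finset.range (S + 1),
            (c * (abar + c) ^ ℓ + c * bbar * (ℓ * (abar + c) ^ (ℓ - 1))) := by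
          refine (Finset.abs_sum_le_sum_abs _ _).trans (Finset.sum_le_sum fun ℓ _ => ?_)
          rw [abs_mul]
          exact (mul_le_of_le_one_left (abs_nonneg _) (hw ℓ)).trans (hd ℓ)
      _ = c * ∑ ℓ ∈ Finset.range (S + 1), (abar + c) ^ ℓ +
            c * bbar * ∑ ℓ ∈ Finset.range (S + 1), (ℓ * (abar + c) ^ (ℓ - 1)) := by
          rw [Finset.sum_add_distrib, Finset.mul_sum, Finset.mul_sum]
      _ ≤ c * (1 - (abar + c))⁻¹ + c * bbar * (1 / (1 - (abar + c)) ^ 2) := by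
          gcongr
          · exact sum_le_hasSum _ (fun ℓ _ => by positivity)
              (hasSum_geometric_of_lt_one hr hsum1)
          · exact sum_range_mul_pow_pred_le hr hsum1 S
      _ = c / (1 - abar - c) + c * bbar / (1 - abar - c) ^ 2 := by
          rw [sub_add_eq_sub_sub, mul_one_div, div_eq_mul_inv c]
  rw [← hsum.sum_add_tsum_nat_add (S + 1), ← sub_sub, ← Finset.sum_sub_distrib]
  simp only [← mul_sub]
  exact (abs_sub _ _).trans (add_le_add hhead htail)
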